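/- arXiv:2503.10590 — 2 statements merged into one kernel-verified Lean document; each statement's English description precedes it below -/
import Mathlib

section
/- Each of the numbers N_III, N_IV, N_V, N_VI, N_X is even, and N_VII is divisible by 4. -/
open scoped Classical

/-- `χ` is the character of an irreducible complex representation of `G`. -/
def IsIrrChar (G : Type) [Group G] (χ : G → ℂ) : Prop :=
  ∃ V : FDRep ℂ G, CategoryTheory.Simple V ∧ χ = V.character

/-- The Frobenius–Schur indicator of a function `χ` on a finite group `G`. -/
noncomputable def FS (G : Type) [Group G] [Finite G] (χ : G → ℂ) : ℂ :=
  (∑ᶠ g : G, χ (g ^ 2)) / (Nat.card G : ℂ)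

theorem conj_mem_of_index_two {Ghat : Type} [Group Ghat] {G : Subgroup Ghat} (h2 : G.index = 2)
    {g : Ghat} (hg : g ∈ G) (x : Ghat) : x * g * x⁻¹ ∈ G := by
  rw [Subgroup.mul_mem_iff_of_index_two h2, Subgroup.mul_mem_iff_of_index_two h2]
  simp [hg, Subgroup.inv_mem_iff]

/-- The twisted Frobenius–Schur indicator, summing over the coset `Ghat \ G`. -/
noncomputable def FSsharp {Ghat : Type} [Group Ghat] [Finite Ghat] (G : Subgroup Ghat)
    (h2 : G.index = 2) (χ : ↥G → ℂ) : ℂ :=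
  (∑ᶠ g ∈ {g : Ghat | g ∉ G}, χ ⟨g ^ 2, Subgroup.sq_mem_of_index_two h2 g⟩) / (Nat.card ↥G : ℂ)

/-- `χ^a`, the complex conjugate character. -/
def aChar {G : Type} [Group G] (χ : G → ℂ) : G → ℂ := fun g => starRingEnd ℂ (χ g)

/-- `χ^b : g ↦ χ(x g x⁻¹)`. -/
def bChar {Ghat : Type} [Group Ghat] {G : Subgroup Ghat} (h2 : G.index = 2) (x : Ghat)
    (χ : ↥G → ℂ) : ↥G → ℂ :=
  fun g => χ ⟨x * ↑g * x⁻¹, conj_mem_of_index_two h2 g.2 x⟩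

/-- `χ^c = conj(χ^b)`. -/
def cChar {Ghat : Type} [Group Ghat] {G : Subgroup Ghat} (h2 : G.index = 2) (x : Ghat)
    (χ : ↥G → ℂ) : ↥G → ℂ := aChar (bChar h2 x χ)

/-- `K` is a conjugacy class of `G`. -/
def IsConjClass (G : Type) [Group G] (K : Set G) : Prop := ∃ g : G, K = {h | IsConj g h}

/-- `K^b = xKx⁻¹`. -/
def bClass {Ghat : Type} [Group Ghat] {G : Subgroup Ghat} (h2 : G.index = 2) (x : Ghat)
    (K : Set ↥G) : Set ↥G :=
  (fun g : ↥G => (⟨x * ↑g * x⁻¹, conj_mem_of_index_two h2 g.2 x⟩ : ↥G)) '' K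

open CategoryTheory in
theorem IsIrrChar.exists_matrix {G : Type} [Group G] {χ : G → ℂ} (h : IsIrrChar G χ) :
    ∃ (n : ℕ) (A : G →* Matrix (Fin n) (Fin n) ℂ), ∀ g, χ g = (A g).trace := by
  obtain ⟨V, -, rfl⟩ := h
  let b := Module.finBasis ℂ V
  refine ⟨_, (LinearMap.toMatrixAlgEquiv b).toMulEquiv.toMonoidHom.comp V.ρ, fun g => ?_⟩
  exact LinearMap.trace_eq_matrix_trace ℂ b (V.ρ g)

theorem IsIrrChar.conj_apply {G : Type} [Group G] {χ : G → ℂ} (h : IsIrrChar G χ) (g k : G) :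
    χ (k * g * k⁻¹) = χ g := by
  obtain ⟨V, -, rfl⟩ := h
  exact V.char_conj g k

open Matrix ComplexOrder in
/-- A complex representation of a finite group is unitarizable, so its trace at `g⁻¹` is the
conjugate of its trace at `g`. -/
theorem trace_map_inv {G n : Type} [Group G] [Finite G] [Fintype n] [DecidableEq n]
    (A : G →* Matrix n n ℂ) (g : G) : (A g⁻¹).trace = starRingEnd ℂ (A g).trace := by
  have := Fintype.ofFinite G
  let H : Matrix n n ℂ := ∑ k, (A k)ᴴ * A k
  have hpos : H.PosDef := by
    have h1 : H = 1 + ∑ k ∈ Finset.univ.erase 1, (A k)ᴴ * A k := by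
      simp only [H]
      rw [← Finset.add_sum_erase _ _ (Finset.mem_univ (1 : G))]
      simp
    rw [h1]
    exact Matrix.PosDef.one.add_posSemidef
      (Matrix.posSemidef_sum _ fun k _ => Matrix.posSemidef_conjTranspose_mul_self _)
  have hinv : (A g)ᴴ * H * A g = H := by
    simp only [H, Finset.mul_sum, Finset.sum_mul]
    refine Fintype.sum_equiv (Equiv.mulRight g) _ _ fun k => ?_
    simp [map_mul, Matrix.conjTranspose_mul, Matrix.mul_assoc]
  have hg : A g * A g⁻¹ = 1 := by rw [← map_mul, mul_inv_cancel, map_one]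
  have hH := (Matrix.isUnit_iff_isUnit_det _).1 hpos.isUnit
  have key : A g⁻¹ = H⁻¹ * (A g)ᴴ * H := by
    have h3 : (A g)ᴴ * H = H * A g⁻¹ := by
      calc (A g)ᴴ * H = (A g)ᴴ * H * (A g * A g⁻¹) := by rw [hg, mul_one]
        _ = (A g)ᴴ * H * A g * A g⁻¹ := by simp only [Matrix.mul_assoc]
        _ = _ := by rw [hinv]
    rw [Matrix.mul_assoc, h3, ← Matrix.mul_assoc, Matrix.nonsing_inv_mul _ hH, one_mul]
  rw [key, Matrix.trace_mul_comm, ← Matrix.mul_assoc, Matrix.mul_nonsing_inv _ hH, one_mul,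
    Matrix.trace_conjTranspose]
  rfl

theorem IsIrrChar.apply_inv {G : Type} [Group G] [Finite G] {χ : G → ℂ} (h : IsIrrChar G χ)
    (g : G) : χ g⁻¹ = starRingEnd ℂ (χ g) := by
  obtain ⟨n, A, hA⟩ := h.exists_matrix
  rw [hA, hA, trace_map_inv]

open CategoryTheory in
theorem IsIrrChar.sum_mul_inv {G : Type} [Group G] [Fintype G] {χ ψ : G → ℂ}
    (hχ : IsIrrChar G χ) (hψ : IsIrrChar G ψ) :
    ∑ g, χ g * ψ g⁻¹ = if χ = ψ then (Nat.card G : ℂ) else 0 := by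
  obtain ⟨V, hV, rfl⟩ := hχ
  obtain ⟨W, hW, rfl⟩ := hψ
  split_ifs with h
  · rw [← h]
    exact (FDRep.simple_iff_char_is_norm_one V).1 hV
  · have := invertibleOfNonzero (NeZero.ne (Nat.card G : ℂ))
    have key := FDRep.char_orthonormal V W
    rw [if_neg fun ⟨i⟩ => h (FDRep.char_iso i)] at key
    exact (mul_eq_zero.1 key).resolve_left (inv_ne_zero (NeZero.ne _))

open CategoryTheory in
theorem IsIrrChar.comp_mulEquiv {G : Type} [Group G] [Finite G] {χ : G → ℂ} (h : IsIrrChar G χ)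
    (φ : G ≃* G) : IsIrrChar G fun g => χ (φ g) := by
  have := Fintype.ofFinite G
  obtain ⟨V, hV, rfl⟩ := h
  have hc : (fun g => V.character (φ g)) = (FDRep.of (V.ρ.comp φ.toMonoidHom)).character := rfl
  refine ⟨_, ?_, hc⟩
  rw [FDRep.simple_iff_char_is_norm_one, ← hc, ← (FDRep.simple_iff_char_is_norm_one V).1 hV]
  exact Fintype.sum_equiv φ.toEquiv _ _ fun g => by simp

open CategoryTheory in
theorem isIrrChar_aChar {G : Type} [Group G] [Finite G] {χ : G → ℂ} (h : IsIrrChar G χ) :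
    IsIrrChar G (aChar χ) := by
  have := Fintype.ofFinite G
  have ha : aChar χ = fun g => χ g⁻¹ := funext fun g => (h.apply_inv g).symm
  rw [ha]
  obtain ⟨V, hV, rfl⟩ := h
  have hc : (fun g => V.character g⁻¹) =
      (FDRep.of (Representation.dual V.ρ)).character := funext fun g => (V.char_dual g).symm
  refine ⟨_, ?_, hc⟩
  rw [FDRep.simple_iff_char_is_norm_one, ← hc, ← (FDRep.simple_iff_char_is_norm_one V).1 hV]
  exact Finset.sum_congr rfl fun g _ => by simp [mul_comm]

theorem trace_eq_sum_single {n : Type} [Fintype n] [DecidableEq n]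
    (f : Matrix n n ℂ →ₗ[ℂ] Matrix n n ℂ) :
    LinearMap.trace ℂ (Matrix n n ℂ) f = ∑ i, ∑ j, f (Matrix.single i j 1) i j := by
  rw [LinearMap.trace_eq_matrix_trace ℂ (Matrix.stdBasis ℂ n n), Matrix.trace,
    Fintype.sum_prod_type]
  refine Finset.sum_congr rfl fun i _ => Finset.sum_congr rfl fun j _ => ?_
  rw [Matrix.diag, LinearMap.toMatrix_apply, Matrix.stdBasis_eq_single]
  rfl

open Matrix in
theorem mul_single_mul_apply {n : Type} [Fintype n] [DecidableEq n] (L R : Matrix n n ℂ)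
    (a b i j : n) : (L * Matrix.single a b (1 : ℂ) * R : Matrix n n ℂ) i j = L i a * R b j := by
  rw [Matrix.mul_assoc, Matrix.mul_apply, Finset.sum_eq_single a]
  · simp
  · intro c _ hc
    simp [Matrix.single_mul_apply_of_ne _ _ _ _ _ hc]
  · simp

theorem dvd_ncard_of_partition {α : Type*} {k : ℕ} (S : Set α) (O : α → Finset α)
    (hmem : ∀ s ∈ S, s ∈ O s) (hsub : ∀ s ∈ S, ∀ t ∈ O s, t ∈ S ∧ O t = O s)
    (hcard : ∀ s ∈ S, (O s).card = k) : k ∣ S.ncard := by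
  by_cases hS : S.Finite
  · lift S to Finset α using hS
    rw [Set.ncard_coe_finset, Finset.card_eq_sum_card_image O S]
    refine Finset.dvd_sum fun T hT => ?_
    obtain ⟨s, hs, rfl⟩ := Finset.mem_image.1 hT
    have : S.filter (fun t => O t = O s) = O s := by
      ext t
      simp only [Finset.mem_filter]
      exact ⟨fun h => h.2 ▸ hmem t h.1, fun h => hsub s hs t h⟩
    rw [this, hcard s hs]
  · simp [Set.Infinite.ncard hS]

theorem even_ncard_of_involution {α : Type*} (S : Set α) (f : α → α)
    (hf : ∀ s ∈ S, f s ∈ S) (hff : ∀ s ∈ S, f (f s) = s) (hne : ∀ s ∈ S, f s ≠ s) :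
    Even S.ncard := by
  refine even_iff_two_dvd.2 (dvd_ncard_of_partition S (fun s => {s, f s}) (by simp) ?_ ?_)
  · intro s hs t ht
    simp only [Finset.mem_insert, Finset.mem_singleton] at ht
    rcases ht with rfl | rfl
    · exact ⟨hs, rfl⟩
    · exact ⟨hf s hs, by rw [hff s hs, Finset.pair_comm]⟩
  · exact fun s hs => Finset.card_pair (hne s hs).symm

theorem four_dvd_ncard_of_involutions {α : Type*} (S : Set α) (f g : α → α)
    (hf : ∀ s ∈ S, f s ∈ S) (hg : ∀ s ∈ S, g s ∈ S)
    (hff : ∀ s ∈ S, f (f s) = s) (hgg : ∀ s ∈ S, g (g s) = s) (hfg : ∀ s ∈ S, f (g s) = g (f s))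
    (hfne : ∀ s ∈ S, f s ≠ s) (hgne : ∀ s ∈ S, g s ≠ s) (hne : ∀ s ∈ S, f s ≠ g s) :
    4 ∣ S.ncard := by
  refine dvd_ncard_of_partition S (fun s => {s, f s, g s, g (f s)}) (by simp) ?_ ?_
  · intro s hs t ht
    simp only [Finset.mem_insert, Finset.mem_singleton] at ht
    have := hf s hs
    have := hg s hs
    have := hf _ (hg s hs)
    have := hg _ (hf s hs)
    refine ⟨by rcases ht with rfl | rfl | rfl | rfl <;> assumption, ?_⟩
    ext u
    simp only [Finset.mem_insert, Finset.mem_singleton]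
    grind
  · intro s hs
    have := hf s hs
    have := hg s hs
    have := hff s hs
    have := hgg s hs
    have := hfg s hs
    have := hfne s hs
    have := hgne s hs
    have := hne s hs
    have := hgne _ (hf s hs)
    have h4 : g (f s) ≠ s := by grind
    have h5 : g (f s) ≠ g s := by grind
    rw [Finset.card_insert_of_notMem, Finset.card_insert_of_notMem, Finset.card_pair] <;>
      grind

open Matrix in
/-- The twisted Frobenius–Schur criterion: the sum is, up to the factor `|G|`, the trace of the
twisted transposition `B ↦ Bᵀ A(z)` on the space of bilinear forms `B` with
`B (φ g v) (g w) = B v w`, which is of dimension at most one. -/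
theorem IsIrrChar.finsum_twisted_ne_zero_iff {G : Type} [Group G] [Finite G] {χ : G → ℂ}
    (hχ : IsIrrChar G χ) (φ : G ≃* G) (z : G) (hz : ∀ g, φ (φ g) = z * g * z⁻¹) :
    ∑ᶠ g, χ (φ g * z * g) ≠ 0 ↔ (fun g => χ (φ g)) = aChar χ := by
  have := Fintype.ofFinite G
  obtain ⟨n, A, hA⟩ := hχ.exists_matrix
  let p : Submodule ℂ (Matrix (Fin n) (Fin n) ℂ) :=
    { carrier := {B | ∀ g, (A (φ g))ᵀ * B * A g = B}
      add_mem' := fun {B C} hB hC g => by rw [mul_add, add_mul, hB g, hC g]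
      zero_mem' := fun g => by simp
      smul_mem' := fun c B hB g => by simp [hB g] }
  let P : Matrix (Fin n) (Fin n) ℂ →ₗ[ℂ] Matrix (Fin n) (Fin n) ℂ := (Nat.card G : ℂ)⁻¹ • ∑ g,
    LinearMap.mulLeft ℂ (A (φ g))ᵀ ∘ₗ LinearMap.mulRight ℂ (A g)
  have hP (B : Matrix (Fin n) (Fin n) ℂ) : P B =
      (Nat.card G : ℂ)⁻¹ • ∑ g, (A (φ g))ᵀ * B * A g := by
    simp [P, LinearMap.sum_apply, mul_assoc]
  have hproj : LinearMap.IsProj p P := by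
    constructor
    · intro B k
      rw [hP, mul_smul_comm, smul_mul_assoc, Finset.mul_sum, Finset.sum_mul]
      congr 1
      refine Fintype.sum_equiv (Equiv.mulRight k) _ _ fun g => ?_
      simp [mul_assoc]
    · intro B hB
      rw [hP, Finset.sum_congr rfl fun g _ => hB g]
      simp [← Nat.cast_smul_eq_nsmul ℂ, smul_smul]
  let θ : Matrix (Fin n) (Fin n) ℂ →ₗ[ℂ] Matrix (Fin n) (Fin n) ℂ := LinearMap.mulRight ℂ (A z) ∘ₗ
    (Matrix.transposeLinearEquiv (Fin n) (Fin n) ℂ ℂ).toLinearMap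
  have hθ (B : Matrix (Fin n) (Fin n) ℂ) : θ B = Bᵀ * A z := rfl
  have hθp (B : Matrix (Fin n) (Fin n) ℂ) (hB : B ∈ p) : θ B ∈ p := by
    intro g
    have h1 : A z * A g = A (φ (φ g)) * A z := by
      rw [← map_mul, ← map_mul, hz, inv_mul_cancel_right]
    calc (A (φ g))ᵀ * θ B * A g = ((A (φ (φ g)))ᵀ * B * A (φ g))ᵀ * A z := by
          simp only [hθ, transpose_mul, transpose_transpose, Matrix.mul_assoc, h1]
      _ = θ B := by rw [hB (φ g), hθ]
  have hθinj : Function.Injective θ := by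
    intro B C h
    have hz1 : A z * A z⁻¹ = 1 := by rw [← map_mul, mul_inv_cancel, map_one]
    have h2 : Bᵀ * A z * A z⁻¹ = Cᵀ * A z * A z⁻¹ := by rw [← hθ, ← hθ, h]
    rw [Matrix.mul_assoc, Matrix.mul_assoc, hz1, mul_one, mul_one] at h2
    exact transpose_injective h2
  have hdim : (Module.finrank ℂ p : ℂ) = if (fun g => χ (φ g)) = aChar χ then 1 else 0 := by
    have h1 := (hχ.comp_mulEquiv φ).sum_mul_inv (isIrrChar_aChar hχ)
    rw [← hproj.trace]
    have h2 : LinearMap.trace ℂ (Matrix (Fin n) (Fin n) ℂ) P =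
        (Nat.card G : ℂ)⁻¹ * ∑ g, χ (φ g) * aChar χ g⁻¹ := by
      simp only [P, map_smul, map_sum, smul_eq_mul]
      congr 1
      refine Finset.sum_congr rfl fun g _ => ?_
      rw [aChar, hχ.apply_inv, Complex.conj_conj, hA, hA, trace_eq_sum_single]
      simp only [LinearMap.comp_apply, LinearMap.mulLeft_apply, LinearMap.mulRight_apply,
        ← Matrix.mul_assoc, mul_single_mul_apply]
      simp [Matrix.trace, Finset.sum_mul_sum]
    rw [h2, h1]
    split_ifs <;> simp
  have htr : LinearMap.trace ℂ p (θ.restrict hθp) =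
      (Nat.card G : ℂ)⁻¹ * ∑ g, χ (φ g * z * g) := by
    have h1 : LinearMap.trace ℂ p (θ.restrict hθp) =
        LinearMap.trace ℂ (Matrix (Fin n) (Fin n) ℂ) (θ ∘ₗ P) := by
      rw [← LinearMap.trace_restrict_eq_of_forall_mem p (θ ∘ₗ P)
        (fun B => hθp _ (hproj.map_mem B)) (fun B _ => hθp _ (hproj.map_mem B))]
      congr 1
      ext1 B
      apply Subtype.ext
      simp [LinearMap.restrict_apply, hproj.map_id B B.2]
    rw [h1]
    have hθP : θ ∘ₗ P = (Nat.card G : ℂ)⁻¹ • ∑ g,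
        θ ∘ₗ LinearMap.mulLeft ℂ (A (φ g))ᵀ ∘ₗ LinearMap.mulRight ℂ (A g) := by
      ext1 B
      simp [P, LinearMap.sum_apply]
    simp only [hθP, map_smul, map_sum, smul_eq_mul]
    congr 1
    refine Finset.sum_congr rfl fun g _ => ?_
    rw [hA, map_mul, map_mul, trace_eq_sum_single]
    have h2 (B : Matrix (Fin n) (Fin n) ℂ) :
        (θ ∘ₗ LinearMap.mulLeft ℂ (A (φ g))ᵀ ∘ₗ LinearMap.mulRight ℂ (A g)) B =
        (A g)ᵀ * Bᵀ * (A (φ g) * A z) := by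
      simp [hθ, Matrix.mul_assoc]
    simp only [h2, Matrix.transpose_single, mul_single_mul_apply]
    rw [Matrix.trace_mul_comm]
    simp only [Matrix.trace, Matrix.diag, Matrix.mul_apply (M := A g), Matrix.transpose_apply]
    exact Finset.sum_comm
  rw [finsum_eq_sum_of_fintype]
  have h3 : ∑ g, χ (φ g * z * g) ≠ 0 ↔ LinearMap.trace ℂ p (θ.restrict hθp) ≠ 0 := by
    simp [htr]
  rw [h3]
  split_ifs at hdim with h
  · have hd : Module.finrank ℂ p = 1 := by exact_mod_cast hdim
    obtain ⟨c, hc, -⟩ := LinearMap.existsUnique_eq_smul_id_of_finrank_eq_one hd (θ.restrict hθp)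
    simp only [h, iff_true]
    intro h0
    rw [hc, map_smul, LinearMap.trace_id, hd] at h0
    have hc0 : c = 0 := by simpa using h0
    have := Module.nontrivial_of_finrank_pos (R := ℂ) (M := p) (by omega)
    obtain ⟨B, hB⟩ := exists_ne (0 : p)
    refine hB (Subtype.ext (hθinj ?_))
    have := LinearMap.congr_fun hc B
    simpa [hc0, Subtype.ext_iff] using this
  · have hd : Module.finrank ℂ p = 0 := by exact_mod_cast hdim
    have := Module.finrank_zero_iff.1 hd
    have h0 : θ.restrict hθp = 0 := Subsingleton.elim _ _
    simp [h, h0]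

theorem FS_ne_zero_iff {G : Type} [Group G] [Finite G] {χ : G → ℂ} (h : IsIrrChar G χ) :
    FS G χ ≠ 0 ↔ aChar χ = χ := by
  have key := h.finsum_twisted_ne_zero_iff (MulEquiv.refl G) 1 (by simp)
  simp only [MulEquiv.refl_apply, mul_one, ← pow_two] at key
  rw [FS, div_ne_zero_iff, key]
  exact (and_iff_left (NeZero.ne _)).trans eq_comm

theorem FS_aChar {G : Type} [Group G] [Finite G] (χ : G → ℂ) :
    FS G (aChar χ) = starRingEnd ℂ (FS G χ) := by
  have := Fintype.ofFinite G
  simp [FS, aChar, finsum_eq_sum_of_fintype]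

theorem FS_comp_mulEquiv {G : Type} [Group G] [Finite G] (χ : G → ℂ) (φ : G ≃* G) :
    FS G (fun g => χ (φ g)) = FS G χ := by
  simp only [FS, map_pow]
  congr 1
  exact finsum_comp_equiv (f := fun g => χ (g ^ 2)) φ.toEquiv

theorem aChar_aChar {G : Type} [Group G] (χ : G → ℂ) : aChar (aChar χ) = χ :=
  funext fun g => Complex.conj_conj (χ g)

theorem even_ncard_of_FS_eq_zero {G : Type} [Group G] [Finite G] (p : (G → ℂ) → Prop)
    (hp : ∀ χ, p χ → p (aChar χ)) :
    Even (Set.ncard {χ : G → ℂ | IsIrrChar G χ ∧ FS G χ = 0 ∧ p χ}) := by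
  refine even_ncard_of_involution _ aChar ?_ (fun χ _ => aChar_aChar χ) ?_
  · rintro χ ⟨h, hF, hχ⟩
    exact ⟨isIrrChar_aChar h, by rw [FS_aChar, hF, map_zero], hp χ hχ⟩
  · rintro χ ⟨h, hF, -⟩ ha
    exact (FS_ne_zero_iff h).2 ha hF

section IndexTwo

variable {Ghat : Type} [Group Ghat] {G : Subgroup Ghat}

/-- Conjugation by `x` as an automorphism of a subgroup of index two. -/
noncomputable def conjEquiv (h2 : G.index = 2) (x : Ghat) : ↥G ≃* ↥G :=
  haveI := Subgroup.normal_of_index_eq_two h2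
  MulAut.conjNormal x

@[simp]
theorem coe_conjEquiv (h2 : G.index = 2) (x : Ghat) (g : ↥G) :
    (conjEquiv h2 x g : Ghat) = x * g * x⁻¹ :=
  haveI := Subgroup.normal_of_index_eq_two h2
  MulAut.conjNormal_apply x g

theorem bChar_eq (h2 : G.index = 2) (x : Ghat) (χ : ↥G → ℂ) :
    bChar h2 x χ = fun g => χ (conjEquiv h2 x g) :=
  funext fun g => congrArg χ (Subtype.ext (coe_conjEquiv h2 x g).symm)

theorem aChar_bChar (h2 : G.index = 2) (x : Ghat) (χ : ↥G → ℂ) :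
    aChar (bChar h2 x χ) = bChar h2 x (aChar χ) := rfl

theorem bChar_bChar {χ : ↥G → ℂ} (h : IsIrrChar ↥G χ) (h2 : G.index = 2) (x : Ghat) :
    bChar h2 x (bChar h2 x χ) = χ := by
  funext g
  rw [← h.conj_apply g ⟨x ^ 2, Subgroup.sq_mem_of_index_two h2 x⟩]
  refine congrArg χ (Subtype.ext ?_)
  simp [pow_two, mul_assoc]

variable [Finite Ghat]

theorem isIrrChar_bChar {χ : ↥G → ℂ} (h : IsIrrChar ↥G χ) (h2 : G.index = 2) (x : Ghat) :
    IsIrrChar ↥G (bChar h2 x χ) := by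
  rw [bChar_eq]
  exact h.comp_mulEquiv _

theorem FS_bChar (h2 : G.index = 2) (x : Ghat) (χ : ↥G → ℂ) :
    FS ↥G (bChar h2 x χ) = FS ↥G χ := by
  rw [bChar_eq, FS_comp_mulEquiv]

theorem FSsharp_aChar (h2 : G.index = 2) (χ : ↥G → ℂ) :
    FSsharp G h2 (aChar χ) = starRingEnd ℂ (FSsharp G h2 χ) := by
  rw [FSsharp, FSsharp, map_div₀, map_natCast]
  congr 1
  exact ((starRingEnd ℂ).toAddMonoidHom.map_finsum_mem _ (Set.toFinite _)).symm

theorem FSsharp_bChar (h2 : G.index = 2) (x : Ghat) (χ : ↥G → ℂ) :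
    FSsharp G h2 (bChar h2 x χ) = FSsharp G h2 χ := by
  have := Subgroup.normal_of_index_eq_two h2
  have hc (y g : Ghat) : y * g * y⁻¹ ∈ G ↔ g ∈ G := by
    rw [this.mem_comm_iff, inv_mul_cancel_left]
  rw [FSsharp, FSsharp]
  congr 1
  refine finsum_mem_eq_of_bijOn (MulAut.conj x) ⟨fun g hg => ?_,
    (MulAut.conj x).injective.injOn, fun g hg => ⟨MulAut.conj x⁻¹ g, ?_, by simp [mul_assoc]⟩⟩
    fun g _ => congrArg χ (Subtype.ext ?_)
  · simpa [hc] using hg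
  · simpa using (hc x⁻¹ g).not.2 hg
  · simp [pow_two, mul_assoc]

theorem FSsharp_eq_finsum (h2 : G.index = 2) {x : Ghat} (hx : x ∉ G) (χ : ↥G → ℂ) :
    FSsharp G h2 χ = (∑ᶠ g : ↥G, χ (conjEquiv h2 x g *
      ⟨x ^ 2, Subgroup.sq_mem_of_index_two h2 x⟩ * g)) / (Nat.card ↥G : ℂ) := by
  rw [FSsharp]
  congr 1
  symm
  rw [← finsum_mem_univ]
  refine finsum_mem_eq_of_bijOn (fun g : ↥G => x * (g : Ghat))
    ⟨fun g _ => ?_, fun g _ k _ hgk => ?_,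
      fun g hg => ⟨⟨x⁻¹ * g, ?_⟩, Set.mem_univ _, by simp⟩⟩ fun g _ => ?_
  · simpa [Subgroup.mul_mem_cancel_right] using hx
  · simpa using hgk
  · rw [Subgroup.mul_mem_iff_of_index_two h2, inv_mem_iff]
    exact iff_of_false hx hg
  · refine congrArg χ (Subtype.ext ?_)
    simp [pow_two, mul_assoc]

theorem FSsharp_ne_zero_iff (h2 : G.index = 2) {x : Ghat} (hx : x ∉ G) {χ : ↥G → ℂ}
    (h : IsIrrChar ↥G χ) : FSsharp G h2 χ ≠ 0 ↔ bChar h2 x χ = aChar χ := by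
  have key := h.finsum_twisted_ne_zero_iff (conjEquiv h2 x)
    ⟨x ^ 2, Subgroup.sq_mem_of_index_two h2 x⟩
    fun g => Subtype.ext (by simp [pow_two, mul_assoc])
  rw [FSsharp_eq_finsum h2 hx, div_ne_zero_iff, key, bChar_eq]
  exact and_iff_left (NeZero.ne _)

theorem even_ncard_of_FS_ne_zero (h2 : G.index = 2) {x : Ghat} (hx : x ∉ G) {ε : ℂ}
    (hε : ε ≠ 0) :
    Even (Set.ncard {χ : ↥G → ℂ | IsIrrChar ↥G χ ∧ FS ↥G χ = ε ∧ FSsharp G h2 χ = 0}) := by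
  refine even_ncard_of_involution _ (bChar h2 x) ?_ (fun χ hχ => bChar_bChar hχ.1 h2 x) ?_
  · rintro χ ⟨h, hF, hS⟩
    exact ⟨isIrrChar_bChar h h2 x, by rw [FS_bChar, hF], by rw [FSsharp_bChar, hS]⟩
  · rintro χ ⟨h, hF, hS⟩ hb
    refine (FSsharp_ne_zero_iff h2 hx h).2 ?_ hS
    rw [hb, (FS_ne_zero_iff h).1 (hF ▸ hε)]

end IndexTwo

/-- Each of `N_III, N_IV, N_V, N_VI, N_X` is even and `N_VII` is divisible by `4`. -/
theorem even_counts {Ghat : Type} [Group Ghat] [Finite Ghat] (G : Subgroup Ghat)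
    (h2 : G.index = 2) (x : Ghat) (hx : x ∉ G) :
    Even (Set.ncard {χ : ↥G → ℂ | IsIrrChar ↥G χ ∧ FS ↥G χ = 1 ∧ FSsharp G h2 χ = 0}) ∧
    Even (Set.ncard {χ : ↥G → ℂ | IsIrrChar ↥G χ ∧ FS ↥G χ = 0 ∧ FSsharp G h2 χ = 0 ∧
      bChar h2 x χ = χ}) ∧
    Even (Set.ncard {χ : ↥G → ℂ | IsIrrChar ↥G χ ∧ FS ↥G χ = 0 ∧ FSsharp G h2 χ = 1}) ∧
    Even (Set.ncard {χ : ↥G → ℂ | IsIrrChar ↥G χ ∧ FS ↥G χ = 0 ∧ FSsharp G h2 χ = -1}) ∧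
    Even (Set.ncard {χ : ↥G → ℂ | IsIrrChar ↥G χ ∧ FS ↥G χ = -1 ∧ FSsharp G h2 χ = 0}) ∧
    4 ∣ Set.ncard {χ : ↥G → ℂ | IsIrrChar ↥G χ ∧ FS ↥G χ = 0 ∧ FSsharp G h2 χ = 0 ∧
      bChar h2 x χ ≠ χ} := by
  refine ⟨even_ncard_of_FS_ne_zero h2 hx one_ne_zero, even_ncard_of_FS_eq_zero _ ?_,
    even_ncard_of_FS_eq_zero _ ?_, even_ncard_of_FS_eq_zero _ ?_,
    even_ncard_of_FS_ne_zero h2 hx (neg_ne_zero.2 one_ne_zero), ?_⟩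
  · rintro χ ⟨hS, hb⟩
    exact ⟨by rw [FSsharp_aChar, hS, map_zero], by rw [← aChar_bChar, hb]⟩
  · intro χ hS
    rw [FSsharp_aChar, hS, map_one]
  · intro χ hS
    rw [FSsharp_aChar, hS, map_neg, map_one]
  refine four_dvd_ncard_of_involutions _ aChar (bChar h2 x) ?_ ?_ (fun χ _ => aChar_aChar χ)
    (fun χ hχ => bChar_bChar hχ.1 h2 x) (fun χ _ => aChar_bChar h2 x χ) ?_
    (fun χ hχ => hχ.2.2.2) ?_
  · rintro χ ⟨h, hF, hS, hb⟩
    refine ⟨isIrrChar_aChar h, by rw [FS_aChar, hF, map_zero],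
      by rw [FSsharp_aChar, hS, map_zero], ?_⟩
    intro hab
    refine hb ?_
    rw [← aChar_aChar (bChar h2 x χ), aChar_bChar, hab, aChar_aChar]
  · rintro χ ⟨h, hF, hS, hb⟩
    refine ⟨isIrrChar_bChar h h2 x, by rw [FS_bChar, hF], by rw [FSsharp_bChar, hS], ?_⟩
    rw [bChar_bChar h]
    exact hb.symm
  · rintro χ ⟨h, hF, -⟩ ha
    exact (FS_ne_zero_iff h).2 ha hF
  · rintro χ ⟨h, -, hS, -⟩ hab
    exact (FSsharp_ne_zero_iff h2 hx h).2 hab.symm hS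
end

section
/- Let χ be an irreducible complex character of G with χ^b = χ, and let ψ be an irreducible complex character of Ĝ such that χ is a constituent of the restriction ψ|_G. Then: (i) ψ|_G = χ; (ii) the irreducible characters of Ĝ whose restriction to G contains χ are exactly ψ and ε⊗ψ, and ψ ≠ ε⊗ψ; (iii) 2·FŜ(ψ) = F(χ) + F♯(χ). -/
open scoped Classical

/-- **Schur's lemma** for endomorphisms given as linear maps. -/
theorem exists_eq_smul_one_of_commute {H : Type} [Group H] (V : FDRep ℂ H) [CategoryTheory.Simple V]
    (A : Module.End ℂ V) (hA : ∀ h, A * V.ρ h = V.ρ h * A) : ∃ c : ℂ, A = c • 1 := by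
  let f : V ⟶ V := ⟨CategoryTheory.InducedCategory.homMk (ModuleCat.ofHom A), fun h => by
    ext v
    exact LinearMap.congr_fun (hA h) v⟩
  obtain ⟨c, hc⟩ := CategoryTheory.endomorphism_simple_eq_smul_id ℂ f
  refine ⟨c, LinearMap.ext fun v => ?_⟩
  exact (congrArg (fun k : V ⟶ V => k.hom.hom.hom v) hc).symm

open scoped ComplexOrder in
theorem FDRep.character_inv {H : Type} [Group H] [Finite H] (V : FDRep ℂ H) (h : H) :
    V.character h⁻¹ = starRingEnd ℂ (V.character h) := by
  have := Fintype.ofFinite H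
  let b := Module.finBasis ℂ V
  let R : H → Matrix _ _ ℂ := fun g => LinearMap.toMatrix b b (V.ρ g)
  have hmul (g k : H) : R (g * k) = R g * R k := by
    simp only [R, map_mul, LinearMap.toMatrix_mul]
  have hone : R 1 = 1 := by simp only [R, map_one, LinearMap.toMatrix_one]
  have htr (g : H) : V.character g = (R g).trace := LinearMap.trace_eq_matrix_trace ℂ b _
  let M := ∑ g, (R g).conjTranspose * R g
  have hM : M.PosDef := by
    have hsum : M = (R 1).conjTranspose * R 1
        + ∑ g ∈ Finset.univ.erase 1, (R g).conjTranspose * R g :=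
      (Finset.add_sum_erase _ _ (Finset.mem_univ 1)).symm
    rw [hsum, hone, Matrix.conjTranspose_one, one_mul]
    exact Matrix.PosDef.one.add_posSemidef
      (Matrix.posSemidef_sum _ fun g _ => Matrix.posSemidef_conjTranspose_mul_self _)
  have hinv : (R h).conjTranspose * M = M * R h⁻¹ := by
    have hinvariant : (R h).conjTranspose * M * R h = M := by
      simp only [M, Finset.mul_sum, Finset.sum_mul]
      refine Fintype.sum_equiv (Equiv.mulRight h) _ _ fun g => ?_
      simp [hmul, Matrix.conjTranspose_mul, mul_assoc]
    calc _ = (R h).conjTranspose * M * (R h * R h⁻¹) := by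
          rw [← hmul, mul_inv_cancel, hone, mul_one]
      _ = _ := by rw [← mul_assoc, hinvariant]
  have hdet : IsUnit M.det := (Matrix.isUnit_iff_isUnit_det M).1 hM.isUnit
  calc V.character h⁻¹ = (M⁻¹ * (M * R h⁻¹)).trace := by
        rw [Matrix.nonsing_inv_mul_cancel_left _ _ hdet, htr]
    _ = (R h).conjTranspose.trace := by
        rw [← hinv, Matrix.trace_mul_comm, Matrix.mul_nonsing_inv_cancel_right _ _ hdet]
    _ = _ := by rw [Matrix.trace_conjTranspose, htr]; rfl

namespace IsIrrChar

variable {H : Type} [Group H]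

theorem map_inv [Finite H] {χ : H → ℂ} (hχ : IsIrrChar H χ) (h : H) :
    χ h⁻¹ = starRingEnd ℂ (χ h) := by
  obtain ⟨V, -, rfl⟩ := hχ
  exact V.character_inv h

theorem map_conj {χ : H → ℂ} (hχ : IsIrrChar H χ) (g h : H) : χ (h * g * h⁻¹) = χ g := by
  obtain ⟨V, -, rfl⟩ := hχ
  exact V.char_conj g h

/-- The irreducible characters are orthogonal. -/
theorem sum_mul_conj [Fintype H] {χ η : H → ℂ} (hχ : IsIrrChar H χ) (hη : IsIrrChar H η) :
    ∑ g, χ g * starRingEnd ℂ (η g) = if χ = η then (Nat.card H : ℂ) else 0 := by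
  obtain ⟨V, hV, rfl⟩ := hχ
  obtain ⟨W, hW, rfl⟩ := hη
  have hcard : (Nat.card H : ℂ) ≠ 0 := Nat.cast_ne_zero.2 Nat.card_pos.ne'
  have := invertibleOfNonzero hcard
  have horth := FDRep.char_orthonormal V W
  have hself := FDRep.char_orthonormal V V
  rw [if_pos ⟨CategoryTheory.Iso.refl V⟩, inv_mul_eq_one₀ hcard] at hself
  simp only [FDRep.character_inv] at horth hself
  split_ifs with h
  · rw [← h, ← hself]
  · rwa [if_neg fun ⟨i⟩ => h (FDRep.char_iso i), mul_eq_zero_iff_left (inv_ne_zero hcard)] at horth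

theorem sum_normSq [Fintype H] {χ : H → ℂ} (hχ : IsIrrChar H χ) :
    ∑ g, Complex.normSq (χ g) = Nat.card H := by
  have h := hχ.sum_mul_conj hχ
  rw [if_pos rfl] at h
  simp only [Complex.mul_conj] at h
  exact_mod_cast h

/-- The multiplicity of an irreducible character in a restriction is a natural number. -/
theorem exists_nat_sum_restrict_mul_conj [Fintype H] {ψ : H → ℂ} (hψ : IsIrrChar H ψ)
    (K : Subgroup H) {χ : K → ℂ} (hχ : IsIrrChar K χ) :
    ∃ m : ℕ, ∑ g : K, ψ g * starRingEnd ℂ (χ g) = m * Nat.card K := by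
  obtain ⟨W, -, rfl⟩ := hψ
  obtain ⟨V, -, rfl⟩ := hχ
  have hcard : (Nat.card K : ℂ) ≠ 0 := Nat.cast_ne_zero.2 Nat.card_pos.ne'
  have := invertibleOfNonzero hcard
  have h := FDRep.scalar_product_char_eq_finrank_equivariant V (FDRep.of (W.ρ.comp K.subtype))
  rw [inv_mul_eq_iff_eq_mul₀ hcard, mul_comm] at h
  simp only [FDRep.character_inv] at h
  exact ⟨_, h⟩

/-- Convolution with a class function acts on an irreducible character by a scalar. -/
theorem exists_sum_mul_eq [Fintype H] {χ : H → ℂ} (hχ : IsIrrChar H χ) {f : H → ℂ}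
    (hf : ∀ g h, f (h * g * h⁻¹) = f g) :
    ∃ c : ℂ, ∀ h, ∑ g, f g * χ (g * h) = c * χ h := by
  obtain ⟨V, hV, rfl⟩ := hχ
  obtain ⟨c, hc⟩ := exists_eq_smul_one_of_commute V (∑ g, f g • V.ρ g) fun h => by
    rw [Finset.sum_mul, Finset.mul_sum]
    refine Fintype.sum_equiv (MulAut.conj h⁻¹).toEquiv _ _ fun g => ?_
    have : f (h⁻¹ * (g * h)) = f g := by simpa [mul_assoc] using hf g h⁻¹
    simp [this, ← map_mul, mul_assoc]
  refine ⟨c, fun h => ?_⟩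
  have htr := congrArg (fun A => LinearMap.trace ℂ V (A * V.ρ h)) hc
  simpa [Finset.sum_mul, ← map_mul, FDRep.character] using htr

end IsIrrChar

section IndexTwo

variable {Ghat : Type} [Group Ghat] {G : Subgroup Ghat}

theorem sum_eq_sum_subgroup_add_sum_not_mem {M : Type*} [AddCommMonoid M] [Fintype Ghat]
    (G : Subgroup Ghat) (f : Ghat → M) :
    ∑ h, f h = ∑ g : G, f g + ∑ h with h ∉ G, f h := by
  rw [← Finset.sum_filter_add_sum_filter_not Finset.univ (· ∈ G)]
  congr 1
  exact Finset.sum_subtype _ (by simp) f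

theorem IsIrrChar.map_conj_of_bChar_eq (h2 : G.index = 2) {x : Ghat} (hx : x ∉ G) {χ : G → ℂ}
    (hχ : IsIrrChar G χ) (hb : bChar h2 x χ = χ) (g : G) (h : Ghat) :
    χ ⟨h * g * h⁻¹, conj_mem_of_index_two h2 g.2 h⟩ = χ g := by
  by_cases hh : h ∈ G
  · exact hχ.map_conj g ⟨h, hh⟩
  · have hy : h * x⁻¹ ∈ G := by
      simp [Subgroup.mul_mem_iff_of_index_two h2, hh, hx]
    rw [← congrFun hb g, bChar,
      ← hχ.map_conj ⟨x * g * x⁻¹, conj_mem_of_index_two h2 g.2 x⟩ ⟨h * x⁻¹, hy⟩]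
    congr 1
    ext
    simp [mul_assoc]

/-- An irreducible character lying over an invariant `χ` restricts to a multiple of `χ`. -/
theorem IsIrrChar.exists_restrict_eq_mul [Fintype Ghat] (h2 : G.index = 2) {x : Ghat} (hx : x ∉ G)
    {χ : G → ℂ} (hχ : IsIrrChar G χ) (hb : bChar h2 x χ = χ) {ψ : Ghat → ℂ} (hψ : IsIrrChar Ghat ψ)
    (hcons : ∑ g : G, ψ g * starRingEnd ℂ (χ g) ≠ 0) :
    ∃ e : ℂ, ∀ g : G, ψ g = e * χ g := by
  obtain ⟨c, hc⟩ := hψ.exists_sum_mul_eq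
    (f := fun h => if hh : h ∈ G then starRingEnd ℂ (χ ⟨h, hh⟩) else 0) fun g h => by
      have hmem : h * g * h⁻¹ ∈ G ↔ g ∈ G :=
        ⟨fun hg => by simpa [mul_assoc] using conj_mem_of_index_two h2 hg h⁻¹,
          fun hg => conj_mem_of_index_two h2 hg h⟩
      by_cases hg : g ∈ G
      · simp only [hmem, hg, dif_pos]
        rw [hχ.map_conj_of_bChar_eq h2 hx hb ⟨g, hg⟩ h]
      · simp [hmem, hg]
  obtain ⟨c', hc'⟩ := hχ.exists_sum_mul_eq (f := fun g : G => starRingEnd ℂ (ψ g))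
    fun g h => congrArg _ (hψ.map_conj g h)
  have hsum (h : Ghat) : ∑ g : G, starRingEnd ℂ (χ g) * ψ (g * h) = c * ψ h := by
    rw [← hc h, sum_eq_sum_subgroup_add_sum_not_mem G, Finset.sum_eq_zero (s := {h | h ∉ G}),
      add_zero]
    · simp
    · intro k hk
      simp [(Finset.mem_filter.1 hk).2]
  have hc0 : c ≠ 0 := by
    rintro rfl
    refine hcons ?_
    simpa [mul_comm] using hsum 1
  refine ⟨starRingEnd ℂ c' / c, fun h => ?_⟩
  rw [div_mul_eq_mul_div, eq_div_iff hc0, mul_comm, ← hsum, ← inv_inv h, hχ.map_inv, ← map_mul,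
    ← hc', map_sum]
  refine Fintype.sum_equiv (Equiv.mulRight h) _ _ fun g => ?_
  simp [mul_comm]

theorem IsIrrChar.restrict_eq [Fintype Ghat] (h2 : G.index = 2) {x : Ghat} (hx : x ∉ G)
    {χ : G → ℂ} (hχ : IsIrrChar G χ) (hb : bChar h2 x χ = χ) {ψ : Ghat → ℂ} (hψ : IsIrrChar Ghat ψ)
    (hcons : ∑ g : G, ψ g * starRingEnd ℂ (χ g) ≠ 0) (g : G) : ψ g = χ g := by
  obtain ⟨e, he⟩ := hχ.exists_restrict_eq_mul h2 hx hb hψ hcons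
  obtain ⟨m, hm⟩ := hψ.exists_nat_sum_restrict_mul_conj G hχ
  have hcard : (Nat.card G : ℂ) ≠ 0 := Nat.cast_ne_zero.2 Nat.card_pos.ne'
  have hm0 : m ≠ 0 := by
    rintro rfl
    simp [hm] at hcons
  have hem : e = m := by
    have h := hχ.sum_mul_conj hχ
    simp only [he, mul_assoc, ← Finset.mul_sum] at hm
    rw [h, if_pos rfl] at hm
    exact mul_right_cancel₀ hcard hm
  have hle : (m : ℝ) ^ 2 * Nat.card G ≤ 2 * Nat.card G := by
    have h := hψ.sum_normSq
    rw [sum_eq_sum_subgroup_add_sum_not_mem G, ← G.card_mul_index, h2] at h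
    simp only [he, hem, Complex.normSq_mul, ← Finset.mul_sum, hχ.sum_normSq] at h
    have hnn : 0 ≤ ∑ h with h ∉ G, Complex.normSq (ψ h) :=
      Finset.sum_nonneg fun _ _ => Complex.normSq_nonneg _
    rw [Complex.normSq_natCast] at h
    push_cast at h
    nlinarith
  have hle' : m ^ 2 ≤ 2 := by
    exact_mod_cast le_of_mul_le_mul_right hle (Nat.cast_pos.2 Nat.card_pos)
  have hm1 : m = 1 := by
    have : m < 2 := by nlinarith
    omega
  rw [he, hem, hm1, Nat.cast_one, one_mul]

/-- An irreducible character whose restriction is irreducible has norm one off `G`. -/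
theorem IsIrrChar.sum_not_mem_normSq [Fintype Ghat] (h2 : G.index = 2) {χ : G → ℂ}
    (hχ : IsIrrChar G χ) {ψ : Ghat → ℂ} (hψ : IsIrrChar Ghat ψ) (hres : ∀ g : G, ψ g = χ g) :
    ∑ h with h ∉ G, Complex.normSq (ψ h) = Nat.card G := by
  have h := hψ.sum_normSq
  rw [sum_eq_sum_subgroup_add_sum_not_mem G, ← G.card_mul_index, h2] at h
  simp only [hres, hχ.sum_normSq] at h
  push_cast at h
  linarith

/-- Two irreducible characters with the same irreducible restriction agree up to the sign of
`Ghat ⧸ G`. -/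
theorem IsIrrChar.eq_or_eq_sign_mul [Fintype Ghat] (h2 : G.index = 2) {χ : G → ℂ}
    (hχ : IsIrrChar G χ) {ψ ψ' : Ghat → ℂ} (hψ : IsIrrChar Ghat ψ) (hψ' : IsIrrChar Ghat ψ')
    (hres : ∀ g : G, ψ g = χ g) (hres' : ∀ g : G, ψ' g = χ g) :
    ψ' = ψ ∨ ψ' = fun h => (if h ∈ G then (1 : ℂ) else -1) * ψ h := by
  refine or_iff_not_imp_left.2 fun hne => ?_
  have horth := hψ'.sum_mul_conj hψ
  rw [if_neg hne, sum_eq_sum_subgroup_add_sum_not_mem G] at horth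
  simp only [hres, hres', hχ.sum_mul_conj hχ, if_true] at horth
  have hre := congrArg Complex.re horth
  rw [Complex.add_re, Complex.re_sum, Complex.natCast_re, Complex.zero_re] at hre
  have hzero : ∑ h with h ∉ G, Complex.normSq (ψ' h + ψ h) = 0 := by
    simp only [Complex.normSq_add, Finset.sum_add_distrib, ← Finset.mul_sum,
      hχ.sum_not_mem_normSq h2 hψ hres, hχ.sum_not_mem_normSq h2 hψ' hres']
    linarith
  rw [Finset.sum_eq_zero_iff_of_nonneg fun _ _ => Complex.normSq_nonneg _] at hzero
  funext h
  by_cases hh : h ∈ G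
  · simpa [hh] using (hres' ⟨h, hh⟩).trans (hres ⟨h, hh⟩).symm
  · simpa [hh] using
      eq_neg_of_add_eq_zero_left (Complex.normSq_eq_zero.1 (hzero h (by simpa using hh)))

end IndexTwo

/-- If `χ^b = χ` and `χ` is a constituent of `ψ|_G`, then `ψ|_G = χ`; the irreducible
characters of `Ĝ` restricting to `χ` are exactly `ψ` and `ε⊗ψ ≠ ψ`; and
`2 FŜ(ψ) = F(χ) + F♯(χ)`. -/
theorem induction_b_fixed {Ghat : Type} [Group Ghat] [Finite Ghat] (G : Subgroup Ghat)
    (h2 : G.index = 2) (x : Ghat) (hx : x ∉ G)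
    (χ : ↥G → ℂ) (hχ : IsIrrChar ↥G χ) (hb : bChar h2 x χ = χ)
    (ψ : Ghat → ℂ) (hψ : IsIrrChar Ghat ψ)
    (hcons : (∑ᶠ g : ↥G, ψ ↑g * starRingEnd ℂ (χ g)) ≠ 0) :
    (∀ g : ↥G, ψ ↑g = χ g) ∧
    (∀ ψ' : Ghat → ℂ, IsIrrChar Ghat ψ' →
      ((∑ᶠ g : ↥G, ψ' ↑g * starRingEnd ℂ (χ g)) ≠ 0 ↔
        ψ' = ψ ∨ ψ' = fun h => (if h ∈ G then (1 : ℂ) else -1) * ψ h)) ∧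
    ψ ≠ (fun h => (if h ∈ G then (1 : ℂ) else -1) * ψ h) ∧
    2 * FS Ghat ψ = FS ↥G χ + FSsharp G h2 χ := by
  have := Fintype.ofFinite Ghat
  simp only [finsum_eq_sum_of_fintype] at hcons ⊢
  have hres := hχ.restrict_eq h2 hx hb hψ hcons
  refine ⟨hres, fun ψ' hψ' => ⟨fun hcons' => ?_, ?_⟩, fun heq => ?_, ?_⟩
  · exact hχ.eq_or_eq_sign_mul h2 hψ hψ' hres (hχ.restrict_eq h2 hx hb hψ' hcons')
  · rintro (rfl | rfl)
    · exact hcons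
    · simpa using hcons
  · have hnorm := hχ.sum_not_mem_normSq h2 hψ hres
    rw [Finset.sum_eq_zero] at hnorm
    · exact ((Nat.cast_ne_zero (R := ℝ)).2 (Nat.card_pos (α := G)).ne') hnorm.symm
    · intro h hh
      have hneg := congrFun heq h
      rw [if_neg (Finset.mem_filter.1 hh).2, neg_one_mul, self_eq_neg] at hneg
      rw [hneg, map_zero]
  · have hsharp : ∑ h with h ∉ G, ψ (h ^ 2)
        = ∑ᶠ g ∈ {g : Ghat | g ∉ G}, χ ⟨g ^ 2, Subgroup.sq_mem_of_index_two h2 g⟩ := by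
      rw [finsum_mem_eq_toFinset_sum, Set.toFinset_ofPred]
      exact Finset.sum_congr rfl fun h _ => hres ⟨h ^ 2, _⟩
    have hG : ∑ g : G, ψ ((g : Ghat) ^ 2) = ∑ g : G, χ (g ^ 2) :=
      Finset.sum_congr rfl fun g _ => hres (g ^ 2)
    have hcard : (Nat.card G : ℂ) ≠ 0 := Nat.cast_ne_zero.2 Nat.card_pos.ne'
    rw [FS, FS, FSsharp, finsum_eq_sum_of_fintype, finsum_eq_sum_of_fintype,
      sum_eq_sum_subgroup_add_sum_not_mem G, hsharp, hG, ← G.card_mul_index, h2]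
    push_cast
    field_simp
end
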